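/- Let m ≥ 1 and p ≥ 0 be integers, b_j ∈ ℝ, β_j > 0 with b_j + β_j > 0 for 1 ≤ j ≤ m, a_i ∈ ℝ, α_i > 0 with a_i + α_i > 0 for 1 ≤ i ≤ p, and Δ = Σ_{j=1}^m β_j − Σ_{i=1}^p α_i > 0. Let γ > max_{1≤j≤m}(−b_j/β_j) and define, for x > 0, H(x) = (1/(2π)) ∫_{t∈ℝ} [Π_{j=1}^m Γ(b_j+β_j(γ+it)) / Π_{i=1}^p Γ(a_i+α_i(γ+it))] x^{−(γ+it)} dt; assume H(x) is real and nonnegative for every x > 0. Then for every integer l ≥ 0 the function x ↦ x^l H(x) is integrable on (0,∞) and ∫₀^∞ x^l H(x) dx = Π_{j=1}^m Γ(b_j+β_j(l+1)) / Π_{i=1}^p Γ(a_i+α_i(l+1)). In particular, the probability density ρ = H/K with K = Π_{j=1}^m Γ(b_j+β_j) / Π_{i=1}^p Γ(a_i+α_i) has finite moments of all orders. -/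

import Mathlib

open MeasureTheory Finset Filter Complex Real

/-- The Fox-H kernel of type `(m,0;p,m)`: `𝓗(s) = ∏_{j<m} Γ(bⱼ+βⱼs) / ∏_{i<p} Γ(aᵢ+αᵢs)`. -/
noncomputable def foxKernelM (m p : ℕ) (a α b β : ℕ → ℝ) (s : ℂ) : ℂ :=
  (∏ j ∈ Finset.range m, Complex.Gamma (b j + β j * s)) /
  (∏ i ∈ Finset.range p, Complex.Gamma (a i + α i * s))

/-- The corresponding Fox-H function on `(0,∞)` defined by the vertical contour `L_{iγ∞}`. -/
noncomputable def foxHposM (m p : ℕ) (a α b β : ℕ → ℝ) (γ : ℝ) (x : ℝ) : ℂ :=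
  (1 / (2 * π)) * ∫ t : ℝ, foxKernelM m p a α b β ((γ : ℂ) + (t : ℂ) * Complex.I) *
    Complex.exp (-((γ : ℂ) + (t : ℂ) * Complex.I) * (Real.log x : ℂ))

lemma integral_cpow_mul_exp_neg_mul_Ioi_of_re_pos {a r : ℂ} (ha : 0 < a.re) (hr : 0 < r.re) :
    ∫ t : ℝ in Set.Ioi 0, (t : ℂ) ^ (a - 1) * Complex.exp (-(r * t)) =
      (1 / r) ^ a * Complex.Gamma a := by
  have hmeas : ∀ b : ℂ, AEStronglyMeasurable (fun t : ℝ => (t : ℂ) ^ b)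
      (volume.restrict (Set.Ioi 0)) := fun b =>
    (continuousOn_of_forall_continuousAt fun t ht =>
      continuousAt_ofReal_cpow_const _ _ (Or.inr (ne_of_gt ht))).aestronglyMeasurable
      measurableSet_Ioi
  have hexp : ∀ r : ℂ, Continuous fun t : ℝ => Complex.exp (-(r * t)) := fun r => by fun_prop
  have hint : ∀ (s : ℝ), -1 < s → ∀ c : ℝ, 0 < c →
      IntegrableOn (fun t : ℝ => t ^ s * Real.exp (-(c * t))) (Set.Ioi 0) := fun s hs c hc => by
    simpa using integrableOn_rpow_mul_exp_neg_mul_rpow hs one_pos hc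
  have hder : ∀ r : ℂ, 0 < r.re → DifferentiableAt ℂ
      (fun r => ∫ t : ℝ in Set.Ioi 0, (t : ℂ) ^ (a - 1) * Complex.exp (-(r * t))) r := by
    intro r hr
    refine (hasDerivAt_integral_of_dominated_loc_of_deriv_le
      (F' := fun r (t : ℝ) => (t : ℂ) ^ (a - 1) * (Complex.exp (-(r * t)) * -(t : ℂ)))
      (bound := fun t => t ^ a.re * Real.exp (-(r.re / 2 * t)))
      (s := {w : ℂ | r.re / 2 < w.re}) ?_ ?_ ?_ ?_ ?_ ?_ ?_).2.differentiableAt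
    · exact (isOpen_lt continuous_const Complex.continuous_re).mem_nhds (by simp; linarith)
    · exact Eventually.of_forall fun w => (hmeas _).mul (hexp w).aestronglyMeasurable
    · refine Integrable.mono' (hint (a.re - 1) (by linarith) r.re hr)
        ((hmeas _).mul (hexp r).aestronglyMeasurable) ?_
      filter_upwards [ae_restrict_mem measurableSet_Ioi] with t ht
      rw [norm_mul, Complex.norm_cpow_eq_rpow_re_of_pos ht, Complex.norm_exp]
      simp
    · exact (hmeas _).mul ((hexp r).mul (by fun_prop)).aestronglyMeasurable
    · filter_upwards [ae_restrict_mem measurableSet_Ioi] with t ht w hw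
      have ht : 0 < t := ht
      have hw : r.re / 2 < w.re := hw
      rw [norm_mul, norm_mul, Complex.norm_cpow_eq_rpow_re_of_pos ht, Complex.norm_exp, norm_neg,
        Complex.norm_real, Real.norm_of_nonneg ht.le]
      have : t ^ a.re = t ^ (a - 1).re * t := by
        rw [← Real.rpow_add_one ht.ne']; simp
      rw [this, mul_assoc, mul_comm t]
      have h2 : (-(w * (t : ℂ))).re = -(w.re * t) := by simp
      rw [h2]
      gcongr
    · exact hint a.re (by linarith) _ (by linarith)
    · refine Eventually.of_forall fun t w _ => ?_
      have : HasDerivAt (fun w : ℂ => -(w * (t : ℂ))) (-(t : ℂ)) w := by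
        exact (hasDerivAt_mul_const (t : ℂ)).neg
      exact this.cexp.const_mul _
  have hopen : IsOpen {w : ℂ | 0 < w.re} := isOpen_lt continuous_const Complex.continuous_re
  have hl : AnalyticOnNhd ℂ
      (fun r => ∫ t : ℝ in Set.Ioi 0, (t : ℂ) ^ (a - 1) * Complex.exp (-(r * t)))
      {w : ℂ | 0 < w.re} :=
    DifferentiableOn.analyticOnNhd (fun w hw => (hder w hw).differentiableWithinAt) hopen
  have hr' : AnalyticOnNhd ℂ (fun r => (1 / r) ^ a * Complex.Gamma a) {w : ℂ | 0 < w.re} := by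
    refine DifferentiableOn.analyticOnNhd (fun w hw => ?_) hopen
    have hw : 0 < w.re := hw
    have hw0 : w ≠ 0 := fun h => by simp [h] at hw
    refine DifferentiableAt.differentiableWithinAt ?_
    refine (DifferentiableAt.cpow_const ?_ ?_).mul_const _
    · exact (differentiableAt_const _).div differentiableAt_id hw0
    · left
      rw [one_div, Complex.inv_re]
      exact div_pos hw (Complex.normSq_pos.2 hw0)
  refine hl.eqOn_of_preconnected_of_frequently_eq hr' (z₀ := 1)
    (convex_halfSpace_re_gt 0).isPreconnected (by simp) ?_ hr
  have hT : Tendsto (fun x : ℝ => (x : ℂ)) (nhdsWithin 1 {1}ᶜ) (nhdsWithin 1 {1}ᶜ) := by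
    refine tendsto_nhdsWithin_iff.2 ⟨?_, ?_⟩
    · exact (Complex.continuous_ofReal.tendsto' 1 1 (by simp)).mono_left nhdsWithin_le_nhds
    · filter_upwards [self_mem_nhdsWithin] with x hx
      simpa using hx
  refine hT.frequently (Eventually.frequently ?_)
  filter_upwards [nhdsWithin_le_nhds (lt_mem_nhds (zero_lt_one' ℝ))] with x hx
  exact Complex.integral_cpow_mul_exp_neg_mul_Ioi ha hx

lemma norm_complexGamma_le {z : ℂ} (hz : 0 < z.re) {θ : ℝ} (hθ : |θ| < π / 2) :
    ‖Complex.Gamma z‖ ≤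
      Real.exp (-(θ * z.im)) * ((1 / Real.cos θ) ^ z.re * Real.Gamma z.re) := by
  have hθ' := abs_lt.1 hθ
  have hc : 0 < Real.cos θ := Real.cos_pos_of_mem_Ioo ⟨hθ'.1, hθ'.2⟩
  have hre : (Complex.exp (θ * I)).re = Real.cos θ := Complex.exp_ofReal_mul_I_re θ
  have h1 := integral_cpow_mul_exp_neg_mul_Ioi_of_re_pos hz (r := Complex.exp (θ * I)) (by rwa [hre])
  have h2 : ‖(1 / Complex.exp (θ * I)) ^ z‖ = Real.exp (θ * z.im) := by
    have : (1 / Complex.exp (θ * I)) = Complex.exp (((-θ : ℝ) : ℂ) * I) := by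
      rw [one_div, ← Complex.exp_neg]; push_cast; ring_nf
    rw [this, Complex.cpow_def_of_ne_zero (Complex.exp_ne_zero _), Complex.norm_exp,
      Complex.log_exp (by simp; linarith [Real.pi_pos]) (by simp; linarith [Real.pi_pos])]
    simp
  have h3 : ‖∫ t : ℝ in Set.Ioi 0, (t : ℂ) ^ (z - 1) * Complex.exp (-(Complex.exp (θ * I) * t))‖ ≤
      (1 / Real.cos θ) ^ z.re * Real.Gamma z.re := by
    rw [← Real.integral_rpow_mul_exp_neg_mul_Ioi hz hc]
    refine (norm_integral_le_integral_norm _).trans_eq ?_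
    refine setIntegral_congr_fun measurableSet_Ioi fun t ht => ?_
    simp only [norm_mul, Complex.norm_cpow_eq_rpow_re_of_pos ht, Complex.norm_exp]
    simp [hre]
  rw [h1, norm_mul, h2] at h3
  rw [Real.exp_neg, inv_mul_eq_div, le_div_iff₀' (Real.exp_pos _)]
  exact h3

lemma exists_norm_Gamma_le {A : ℝ} (hA : 0 < A) (B : ℝ) {θ : ℝ} (h0 : 0 ≤ θ) (hθ : θ < π / 2) :
    ∃ C : ℝ, 0 ≤ C ∧ ∀ z : ℂ, A ≤ z.re → z.re ≤ B →
      ‖Complex.Gamma z‖ ≤ C * Real.exp (-(θ * |z.im|)) := by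
  have hc : 0 < Real.cos θ := Real.cos_pos_of_mem_Ioo ⟨by linarith [Real.pi_pos], hθ⟩
  have hcont : ContinuousOn (fun σ : ℝ => (1 / Real.cos θ) ^ σ * Real.Gamma σ) (Set.Icc A B) := by
    refine ContinuousOn.mul (Continuous.continuousOn ?_) fun σ hσ => ?_
    · exact Real.continuous_const_rpow (by positivity)
    · refine (Real.differentiableAt_Gamma fun n => ?_).continuousAt.continuousWithinAt
      have : (0 : ℝ) ≤ n := n.cast_nonneg
      linarith [hσ.1]
  obtain ⟨C, hC⟩ := isCompact_Icc.exists_bound_of_continuousOn hcont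
  refine ⟨max C 0, le_max_right _ _, fun z h1 h2 => ?_⟩
  have hb : (1 / Real.cos θ) ^ z.re * Real.Gamma z.re ≤ max C 0 :=
    (le_abs_self _).trans ((hC _ ⟨h1, h2⟩).trans (le_max_left _ _))
  have hz : 0 < z.re := hA.trans_le h1
  rw [mul_comm]
  rcases le_total 0 z.im with h | h
  · rw [abs_of_nonneg h]
    exact (norm_complexGamma_le hz (by rwa [abs_of_nonneg h0])).trans (by gcongr)
  · rw [abs_of_nonpos h]
    refine (norm_complexGamma_le hz (θ := -θ) (by rwa [abs_neg, abs_of_nonneg h0])).trans ?_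
    rw [Real.cos_neg, neg_mul, mul_neg]
    gcongr

lemma norm_complexSin_le (z : ℂ) : ‖Complex.sin z‖ ≤ Real.exp |z.im| := by
  rw [Complex.sin, norm_div, norm_mul]
  have h := norm_sub_le (Complex.exp (-z * I)) (Complex.exp (z * I))
  rw [Complex.norm_exp, Complex.norm_exp] at h
  simp at h ⊢
  have h1 : Real.exp z.im ≤ Real.exp |z.im| := Real.exp_le_exp.2 (le_abs_self _)
  have h2 : Real.exp (-z.im) ≤ Real.exp |z.im| := Real.exp_le_exp.2 (neg_le_abs _)
  linarith

lemma inv_Gamma_eq_Gamma_one_sub_mul_sin {z : ℂ} (hz : z.re < 1) :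
    (Complex.Gamma z)⁻¹ = Complex.Gamma (1 - z) * Complex.sin (π * z) / π := by
  have hne : Complex.Gamma (1 - z) ≠ 0 := Complex.Gamma_ne_zero_of_re_pos (by simpa using hz)
  have h := Complex.Gamma_mul_Gamma_one_sub z
  have : Complex.Gamma z = π / Complex.sin (π * z) / Complex.Gamma (1 - z) := by
    rw [← h, mul_div_cancel_right₀ _ hne]
  rw [this, inv_div, div_div_eq_mul_div]

lemma exists_norm_inv_Gamma_le (A B : ℝ) {θ : ℝ} (h0 : 0 ≤ θ) (hθ : θ < π / 2) :
    ∃ C : ℝ, 0 ≤ C ∧ ∀ z : ℂ, A ≤ z.re → z.re ≤ B →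
      ‖(Complex.Gamma z)⁻¹‖ ≤ C * Real.exp ((π - θ) * |z.im|) := by
  have hpi := Real.pi_pos
  obtain ⟨n, hn⟩ := exists_nat_ge (B - 1 / 2)
  induction n generalizing A B with
  | zero =>
    obtain ⟨C, hC0, hC⟩ := exists_norm_Gamma_le (A := 1 / 2) (by norm_num) (1 - A) h0 hθ
    refine ⟨C / π, by positivity, fun z h1 h2 => ?_⟩
    simp at hn
    rw [inv_Gamma_eq_Gamma_one_sub_mul_sin (by linarith), norm_div, norm_mul, Complex.norm_real,
      Real.norm_of_nonneg hpi.le, div_mul_eq_mul_div]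
    have hG := hC (1 - z) (by simp; linarith) (by simp; linarith)
    have hS := norm_complexSin_le (π * z)
    have him : |((π : ℂ) * z).im| = π * |z.im| := by simp [abs_mul, abs_of_pos hpi]
    rw [him] at hS
    have him' : |(1 - z).im| = |z.im| := by simp
    rw [him'] at hG
    refine div_le_div_of_nonneg_right ?_ hpi.le
    refine (mul_le_mul hG hS (norm_nonneg _) (by positivity)).trans_eq ?_
    rw [mul_assoc, ← Real.exp_add]
    ring_nf
  | succ n ih =>
    obtain ⟨C, hC0, hC⟩ := ih (A - 1) (B - 1) (by push_cast at hn; linarith)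
    have hK : IsCompact (Set.Icc A B ×ℂ Set.Icc (-1) 1) := isCompact_Icc.reProdIm isCompact_Icc
    obtain ⟨D, hD⟩ := hK.exists_bound_of_continuousOn
      Complex.differentiable_one_div_Gamma.continuous.continuousOn
    refine ⟨max C D, le_max_of_le_left hC0, fun z h1 h2 => ?_⟩
    rcases le_total |z.im| 1 with h | h
    · have := hD z (by
        rw [Complex.mem_reProdIm]; exact ⟨⟨h1, h2⟩, abs_le.1 h⟩)
      have hD0 : 0 ≤ D := (norm_nonneg _).trans this
      calc _ ≤ D := this
        _ ≤ max C D * 1 := by rw [mul_one]; exact le_max_right _ _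
        _ ≤ _ := by
          refine mul_le_mul_of_nonneg_left ?_ (le_max_of_le_left hC0)
          exact Real.one_le_exp (mul_nonneg (by linarith) (abs_nonneg _))
    · have hz1 : 1 ≤ ‖z - 1‖ := h.trans (by simpa using Complex.abs_im_le_norm (z - 1))
      have hr := Complex.one_div_Gamma_eq_self_mul_one_div_Gamma_add_one (z - 1)
      rw [sub_add_cancel] at hr
      have hb := hC (z - 1) (by simpa using h1) (by simpa using h2)
      rw [hr, norm_mul] at hb
      have him : (z - 1).im = z.im := by simp
      rw [him] at hb
      calc _ ≤ ‖z - 1‖ * ‖(Complex.Gamma z)⁻¹‖ := le_mul_of_one_le_left (norm_nonneg _) hz1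
        _ ≤ _ := hb
        _ ≤ _ := by gcongr; exact le_max_left _ _

lemma integrable_exp_neg_mul_abs {c : ℝ} (hc : 0 < c) :
    Integrable fun t : ℝ => Real.exp (-(c * |t|)) := by
  rw [← integrableOn_univ, ← Set.Iic_union_Ioi (a := (0 : ℝ)), integrableOn_union]
  constructor
  · refine (integrableOn_exp_mul_Iic hc 0).congr_fun (fun t ht => ?_) measurableSet_Iic
    simp [abs_of_nonpos (Set.mem_Iic.1 ht)]
  · refine (exp_neg_integrableOn_Ioi 0 hc).congr_fun (fun t ht => ?_) measurableSet_Ioi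
    simp [abs_of_pos (Set.mem_Ioi.1 ht)]

lemma exists_norm_prod_le {n : ℕ} {f : ℕ → ℂ → ℂ} {S : Set ℂ} {k : ℕ → ℝ}
    (h : ∀ j < n, ∃ C : ℝ, 0 ≤ C ∧ ∀ z ∈ S, ‖f j z‖ ≤ C * Real.exp (k j * |z.im|)) :
    ∃ C : ℝ, 0 ≤ C ∧ ∀ z ∈ S,
      ‖∏ j ∈ Finset.range n, f j z‖ ≤ C * Real.exp ((∑ j ∈ Finset.range n, k j) * |z.im|) := by
  choose! C hC0 hC using h
  refine ⟨∏ j ∈ Finset.range n, C j,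
    Finset.prod_nonneg fun j hj => hC0 j (Finset.mem_range.1 hj), fun z hz => ?_⟩
  rw [norm_prod, Finset.sum_mul, Real.exp_sum, ← Finset.prod_mul_distrib]
  exact Finset.prod_le_prod (fun _ _ => norm_nonneg _)
    fun j hj => hC j (Finset.mem_range.1 hj) z hz

/-- `F` decays exponentially in `|Im z|`, uniformly on the strip `A ≤ Re z ≤ B`. -/
def HasStripDecay (F : ℂ → ℂ) (A B : ℝ) : Prop :=
  ∃ C c : ℝ, 0 < c ∧ ∀ z : ℂ, A ≤ z.re → z.re ≤ B → ‖F z‖ ≤ C * Real.exp (-(c * |z.im|))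

lemma foxKernelM_hasStripDecay {m p : ℕ} {a α b β : ℕ → ℝ}
    (hα : ∀ i < p, 0 < α i) (hβ : ∀ j < m, 0 < β j)
    (hΔ : 0 < ∑ j ∈ Finset.range m, β j - ∑ i ∈ Finset.range p, α i)
    {A : ℝ} (hA : ∀ j < m, 0 < b j + β j * A) (B : ℝ) :
    HasStripDecay (foxKernelM m p a α b β) A B := by
  have hpi := Real.pi_pos
  set Sb := ∑ j ∈ Finset.range m, β j
  set Sa := ∑ i ∈ Finset.range p, α i
  have hSa : 0 ≤ Sa := Finset.sum_nonneg fun i hi => (hα i (Finset.mem_range.1 hi)).le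
  obtain ⟨θ, h0, hθ, hc⟩ : ∃ θ, 0 ≤ θ ∧ θ < π / 2 ∧ 0 < θ * Sb - (π - θ) * Sa := by
    have hS : 0 < Sb + Sa := by linarith
    have h1 : (Sb - Sa) / (Sb + Sa) ≤ 1 := (div_le_one hS).2 (by linarith)
    have h2 : 0 < (Sb - Sa) / (Sb + Sa) := by positivity
    refine ⟨π / 2 - π / 4 * ((Sb - Sa) / (Sb + Sa)), by nlinarith, by nlinarith, ?_⟩
    have h3 : (π / 2 - π / 4 * ((Sb - Sa) / (Sb + Sa))) * Sb
        - (π - (π / 2 - π / 4 * ((Sb - Sa) / (Sb + Sa)))) * Sa = π / 4 * (Sb - Sa) := by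
      field_simp
      ring
    rw [h3]
    positivity
  obtain ⟨C, hC0, hC⟩ := exists_norm_prod_le (n := m) (S := {z | A ≤ z.re ∧ z.re ≤ B})
    (f := fun j z => Complex.Gamma (b j + β j * z)) (k := fun j => -(θ * β j)) fun j hj => by
      obtain ⟨C, hC0, hC⟩ := exists_norm_Gamma_le (hA j hj) (b j + β j * B) h0 hθ
      have := hβ j hj
      refine ⟨C, hC0, fun z hz => (hC _ ?_ ?_).trans_eq ?_⟩
      · simpa using mul_le_mul_of_nonneg_left hz.1 this.le
      · simpa using mul_le_mul_of_nonneg_left hz.2 this.le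
      · simp [abs_mul, abs_of_pos this, mul_assoc]
  obtain ⟨D, hD0, hD⟩ := exists_norm_prod_le (n := p) (S := {z | A ≤ z.re ∧ z.re ≤ B})
    (f := fun i z => (Complex.Gamma (a i + α i * z))⁻¹) (k := fun i => (π - θ) * α i)
    fun i hi => by
      obtain ⟨C, hC0, hC⟩ := exists_norm_inv_Gamma_le (a i + α i * A) (a i + α i * B) h0 hθ
      have := hα i hi
      refine ⟨C, hC0, fun z hz => (hC _ ?_ ?_).trans_eq ?_⟩
      · simpa using mul_le_mul_of_nonneg_left hz.1 this.le
      · simpa using mul_le_mul_of_nonneg_left hz.2 this.le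
      · simp [abs_mul, abs_of_pos this, mul_assoc]
  refine ⟨C * D, _, hc, fun z h1 h2 => ?_⟩
  rw [foxKernelM, div_eq_mul_inv, ← Finset.prod_inv_distrib, norm_mul]
  refine (mul_le_mul (hC z ⟨h1, h2⟩) (hD z ⟨h1, h2⟩) (norm_nonneg _)
    (by positivity)).trans_eq ?_
  rw [mul_mul_mul_comm, ← Real.exp_add, ← Finset.mul_sum, Finset.sum_neg_distrib,
    ← Finset.mul_sum]
  congr 2
  ring

lemma foxKernelM_differentiableOn {m p : ℕ} {a α b β : ℕ → ℝ} {U : Set ℂ}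
    (hU : ∀ z ∈ U, ∀ j < m, 0 < b j + β j * z.re) :
    DifferentiableOn ℂ (foxKernelM m p a α b β) U := by
  intro z hz
  refine DifferentiableAt.differentiableWithinAt ?_
  have h : foxKernelM m p a α b β = fun s =>
      (∏ j ∈ Finset.range m, Complex.Gamma (b j + β j * s)) *
      (∏ i ∈ Finset.range p, (Complex.Gamma (a i + α i * s))⁻¹) := by
    ext s
    rw [foxKernelM, div_eq_mul_inv, ← Finset.prod_inv_distrib]
  rw [h]
  refine DifferentiableAt.mul (DifferentiableAt.fun_finsetProd fun j hj => ?_)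
    (DifferentiableAt.fun_finsetProd fun i _ => ?_)
  · refine DifferentiableAt.comp z (Complex.differentiableAt_Gamma _ fun n hn => ?_) (by fun_prop)
    have h1 := hU z hz j (Finset.mem_range.1 hj)
    have h2 := congrArg Complex.re hn
    simp at h2
    have : (0 : ℝ) ≤ n := n.cast_nonneg
    linarith
  · exact (Complex.differentiable_one_div_Gamma _).comp z
      (f := fun s : ℂ => (a i : ℂ) + α i * s) (by fun_prop)

section Contour

variable {F : ℂ → ℂ} {A B : ℝ}

lemma HasStripDecay.mul_cexp (h : HasStripDecay F A B) (w : ℝ) :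
    HasStripDecay (fun s => F s * Complex.exp (-s * (w : ℂ))) A B := by
  obtain ⟨C, c, hc, h⟩ := h
  refine ⟨max C 0 * Real.exp (max |A| |B| * |w|), c, hc, fun z h1 h2 => ?_⟩
  rw [norm_mul, Complex.norm_exp, mul_right_comm]
  have hz : |z.re| ≤ max |A| |B| := abs_le_max_abs_abs h1 h2
  have hw : (-z * (w : ℂ)).re ≤ max |A| |B| * |w| := by
    have : (-z * (w : ℂ)).re = -z.re * w := by simp
    rw [this]
    refine (le_abs_self _).trans ?_
    rw [abs_mul, abs_neg]
    gcongr
  gcongr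
  exact (h z h1 h2).trans (by gcongr; exact le_max_left _ _)

lemma continuous_vertical (hF : DifferentiableOn ℂ F {z | A ≤ z.re ∧ z.re ≤ B})
    {σ : ℝ} (h1 : A ≤ σ) (h2 : σ ≤ B) : Continuous fun t : ℝ => F (σ + t * I) := by
  refine hF.continuousOn.comp_continuous (by fun_prop) fun t => ?_
  simpa using ⟨h1, h2⟩

lemma HasStripDecay.integrable_vertical (h : HasStripDecay F A B)
    (hF : DifferentiableOn ℂ F {z | A ≤ z.re ∧ z.re ≤ B})
    {σ : ℝ} (h1 : A ≤ σ) (h2 : σ ≤ B) : Integrable fun t : ℝ => F (σ + t * I) := by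
  obtain ⟨C, c, hc, h⟩ := h
  refine Integrable.mono' ((integrable_exp_neg_mul_abs hc).const_mul C)
    (continuous_vertical hF h1 h2).aestronglyMeasurable (Eventually.of_forall fun t => ?_)
  simpa using h (σ + t * I) (by simpa using h1) (by simpa using h2)

/-- Shifting a vertical contour across a strip of holomorphy and exponential decay. -/
lemma HasStripDecay.integral_vertical_eq (hAB : A ≤ B) (h : HasStripDecay F A B)
    (hF : DifferentiableOn ℂ F {z | A ≤ z.re ∧ z.re ≤ B}) :
    ∫ t : ℝ, F (A + t * I) = ∫ t : ℝ, F (B + t * I) := by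
  have hA := intervalIntegral_tendsto_integral (h.integrable_vertical hF le_rfl hAB)
    tendsto_neg_atTop_atBot tendsto_id
  have hB := intervalIntegral_tendsto_integral (h.integrable_vertical hF hAB le_rfl)
    tendsto_neg_atTop_atBot tendsto_id
  obtain ⟨C, c, hc, hbound⟩ := h
  have hexp : Tendsto (fun T : ℝ => C * Real.exp (-(c * |T|)) * |B - A|) atTop (nhds 0) := by
    have : Tendsto (fun T : ℝ => Real.exp (-(c * |T|))) atTop (nhds 0) :=
      Real.tendsto_exp_neg_atTop_nhds_zero.comp
        (tendsto_abs_atTop_atTop.const_mul_atTop hc)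
    simpa using (this.const_mul C).mul_const |B - A|
  have hhor : ∀ T : ℝ, ‖∫ x : ℝ in A..B, F (x + T * I)‖ ≤ C * Real.exp (-(c * |T|)) * |B - A| :=
    fun T => intervalIntegral.norm_integral_le_of_norm_le_const fun x hx => by
      rw [Set.uIoc_of_le hAB] at hx
      simpa using hbound (x + T * I) (by simpa using hx.1.le) (by simpa using hx.2)
  have htop : Tendsto (fun T : ℝ => ∫ x : ℝ in A..B, F (x + T * I)) atTop (nhds 0) :=
    squeeze_zero_norm hhor hexp
  have hbot : Tendsto (fun T : ℝ => ∫ x : ℝ in A..B, F (x + (-T : ℝ) * I)) atTop (nhds 0) :=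
    squeeze_zero_norm (fun T => by simpa only [abs_neg] using hhor (-T)) hexp
  have hrect : ∀ T : ℝ, (∫ x : ℝ in A..B, F (x + (-T : ℝ) * I)) - (∫ x : ℝ in A..B, F (x + T * I))
      + I * (∫ t : ℝ in -T..T, F (B + t * I)) - I * (∫ t : ℝ in -T..T, F (A + t * I)) = 0 := by
    intro T
    have := Complex.integral_boundary_rect_eq_zero_of_differentiableOn F ⟨A, -T⟩ ⟨B, T⟩
      (hF.mono fun z hz => by
        have := hz.1
        simpa [Set.uIcc_of_le hAB] using this)
    simpa using this
  have hlim := ((hbot.sub htop).add (hB.const_mul I)).sub (hA.const_mul I)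
  have h0 := tendsto_nhds_unique hlim (tendsto_const_nhds.congr fun T => (hrect T).symm)
  simp only [sub_self, zero_add, ← mul_sub, mul_eq_zero, Complex.I_ne_zero, false_or] at h0
  exact (sub_eq_zero.1 h0).symm

end Contour

section MellinInversion

open scoped FourierTransform

lemma exp_smul_mellinInv_exp_neg (σ : ℝ) (f : ℂ → ℂ) (u : ℝ) :
    Real.exp (-σ * u) • mellinInv σ f (Real.exp (-u)) =
      𝓕⁻ (fun y : ℝ => f (σ + 2 * π * y * I)) u := by
  rw [mellinInv_eq_fourierInv _ _ (Real.exp_pos _), Real.log_exp, neg_neg, ← smul_assoc]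
  have : Real.exp (-σ * u) • ((Real.exp (-u) : ℝ) : ℂ) ^ (-σ : ℂ) = 1 := by
    rw [← Complex.ofReal_neg, ← Complex.ofReal_cpow (Real.exp_pos _).le, ← Real.exp_mul,
      Complex.real_smul, ← Complex.ofReal_mul, ← Real.exp_add,
      show -σ * u + -u * -σ = 0 by ring, Real.exp_zero, Complex.ofReal_one]
  rw [this, one_smul]

lemma MellinConvergent.integrable_exp_smul {f : ℝ → ℂ} {σ : ℝ} (hf : MellinConvergent f σ) :
    Integrable fun u : ℝ => Real.exp (-σ * u) • f (Real.exp (-u)) := by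
  have himage : (fun u : ℝ => Real.exp (-u)) '' Set.univ = Set.Ioi 0 := by
    rw [Set.image_univ]
    exact (neg_surjective.range_comp Real.exp).trans Real.range_exp
  have hderiv : ∀ u ∈ Set.univ, HasDerivWithinAt (fun u : ℝ => Real.exp (-u))
      (-Real.exp (-u)) Set.univ u := fun u _ => by
    simpa only [mul_neg_one] using (hasDerivAt_neg u).exp.hasDerivWithinAt
  have hinj : Set.InjOn (fun u : ℝ => Real.exp (-u)) Set.univ :=
    (Real.exp_injective.comp neg_injective).injOn
  rw [MellinConvergent, ← himage, integrableOn_image_iff_integrableOn_abs_deriv_smul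
    MeasurableSet.univ hderiv hinj, integrableOn_univ] at hf
  refine hf.congr (Eventually.of_forall fun u => ?_)
  have h1 : (((Real.exp (-u) : ℝ) : ℂ) ^ ((σ : ℂ) - 1)) =
      ((Real.exp (-u * (σ - 1)) : ℝ) : ℂ) := by
    rw [Real.exp_mul, Complex.ofReal_cpow (Real.exp_pos _).le]
    simp
  simp only [h1, abs_neg, abs_of_pos (Real.exp_pos _), Complex.real_smul, smul_eq_mul]
  rw [← mul_assoc, ← Complex.ofReal_mul, ← Real.exp_add]
  ring_nf

/-- The Mellin transform of the inverse Mellin transform of `f`, at the real point of the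
contour. -/
lemma mellin_mellinInv_eq {σ : ℝ} {f : ℂ → ℂ} (hf : Complex.VerticalIntegrable f σ)
    (hcont : Continuous fun t : ℝ => f (σ + t * I))
    (hconv : MellinConvergent (mellinInv σ f) σ) : mellin (mellinInv σ f) σ = f σ := by
  set g : ℝ → ℂ := fun y => f (σ + 2 * π * y * I) with hg
  have hgf : g = fun y => (fun t : ℝ => f (σ + t * I)) (y * (2 * π)) := by
    ext y; simp only [hg]; congr 2; push_cast; ring
  have hgi : Integrable g := by
    rw [hgf]
    exact Integrable.comp_mul_right' (g := fun t : ℝ => f (σ + t * I)) hf (by positivity)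
  have hgc : Continuous g := by
    rw [hgf]
    exact hcont.comp (by fun_prop)
  have hinv : Integrable (𝓕⁻ g) := by
    refine hconv.integrable_exp_smul.congr (Eventually.of_forall fun u => ?_)
    exact exp_smul_mellinInv_exp_neg σ f u
  have hfour : Integrable (𝓕 g) := by
    refine hinv.comp_neg.congr (Eventually.of_forall fun u => ?_)
    simp [Real.fourierInv_eq_fourier_neg]
  rw [mellin_eq_fourier]
  simp only [Complex.ofReal_re, Complex.ofReal_im, zero_div, exp_smul_mellinInv_exp_neg]
  change 𝓕 (𝓕⁻ g) 0 = f σ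
  rw [hgc.fourier_fourierInv_eq hgi hfour]
  simp [hg]

lemma continuousOn_mellinInv {σ : ℝ} {f : ℂ → ℂ} (hf : Complex.VerticalIntegrable f σ) :
    ContinuousOn (mellinInv σ f) (Set.Ioi 0) := by
  have hgi : Integrable fun y : ℝ => f (σ + 2 * π * y * I) := by
    refine (Integrable.comp_mul_right' (g := fun t : ℝ => f (σ + t * I)) hf
      (R := 2 * π) (by positivity)).congr (Eventually.of_forall fun y => ?_)
    simp only
    congr 2; push_cast; ring
  have hc : Continuous (𝓕 fun y : ℝ => f (σ + 2 * π * y * I)) :=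
    VectorFourier.fourierIntegral_continuous Real.continuous_fourierChar
      (innerSL ℝ).continuous₂ hgi
  refine ContinuousOn.congr (f := fun x : ℝ => (x : ℂ) ^ (-σ : ℂ) •
    𝓕 (fun y : ℝ => f (σ + 2 * π * y * I)) (Real.log x)) ?_ fun x hx => ?_
  · refine ContinuousOn.smul (continuousOn_of_forall_continuousAt fun t ht =>
      continuousAt_ofReal_cpow_const _ _ (Or.inr (ne_of_gt ht))) ?_
    exact hc.comp_continuousOn (Real.continuousOn_log.mono fun x hx => ne_of_gt hx)
  · rw [mellinInv_eq_fourierInv _ _ hx, Real.fourierInv_eq_fourier_neg, neg_neg]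

end MellinInversion

section FoxH

variable {m p : ℕ} {a α b β : ℕ → ℝ}

lemma foxHposM_eq_mellinInv (γ : ℝ) {x : ℝ} (hx : 0 < x) :
    foxHposM m p a α b β γ x = mellinInv γ (foxKernelM m p a α b β) x := by
  rw [foxHposM, mellinInv, ← smul_eq_mul]
  have h : (1 / (2 * (π : ℂ))) = ((1 / (2 * π) : ℝ) : ℂ) := by push_cast; rfl
  rw [h, smul_eq_mul, ← Complex.real_smul]
  congr 2
  ext t
  rw [Complex.cpow_def_of_ne_zero (by exact_mod_cast hx.ne'), smul_eq_mul,
    ← Complex.ofReal_log hx.le, mul_comm, mul_comm (Real.log x : ℂ)]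

lemma foxHposM_norm_le (γ : ℝ) {x : ℝ} (hx : 0 < x) :
    ‖foxHposM m p a α b β γ x‖ ≤
      (1 / (2 * π) * ∫ t : ℝ, ‖foxKernelM m p a α b β (γ + t * I)‖) * x ^ (-γ) := by
  rw [foxHposM, norm_mul, mul_assoc, ← integral_mul_const]
  have hpi := Real.pi_pos
  have h : ‖(1 / (2 * (π : ℂ)))‖ = 1 / (2 * π) := by
    simp [abs_of_pos hpi]
  rw [h]
  refine mul_le_mul_of_nonneg_left ((norm_integral_le_integral_norm _).trans_eq ?_) (by positivity)
  congr 1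
  ext t
  rw [norm_mul, Complex.norm_exp, Real.rpow_def_of_pos hx]
  simp [mul_comm]

lemma foxHposM_eq_of_le (hα : ∀ i < p, 0 < α i) (hβ : ∀ j < m, 0 < β j)
    (hΔ : 0 < ∑ j ∈ Finset.range m, β j - ∑ i ∈ Finset.range p, α i)
    {A B : ℝ} (hA : ∀ j < m, 0 < b j + β j * A) (hAB : A ≤ B) (x : ℝ) :
    foxHposM m p a α b β A x = foxHposM m p a α b β B x := by
  have hd := (foxKernelM_hasStripDecay (a := a) hα hβ hΔ hA B).mul_cexp (Real.log x)
  rw [foxHposM, foxHposM]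
  congr 1
  refine hd.integral_vertical_eq hAB (DifferentiableOn.mul (foxKernelM_differentiableOn ?_) ?_)
  · intro z hz j hj
    linarith [hA j hj, mul_le_mul_of_nonneg_left hz.1 (hβ j hj).le]
  · exact Differentiable.differentiableOn (by fun_prop)

lemma foxHposM_eq (hα : ∀ i < p, 0 < α i) (hβ : ∀ j < m, 0 < β j)
    (hΔ : 0 < ∑ j ∈ Finset.range m, β j - ∑ i ∈ Finset.range p, α i)
    {A B : ℝ} (hA : ∀ j < m, 0 < b j + β j * A) (hB : ∀ j < m, 0 < b j + β j * B) :
    foxHposM m p a α b β A = foxHposM m p a α b β B := by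
  ext x
  rcases le_total A B with h | h
  · exact foxHposM_eq_of_le hα hβ hΔ hA h x
  · exact (foxHposM_eq_of_le hα hβ hΔ hB h x).symm

lemma foxHposM_isBigO (γ : ℝ) {l : Filter ℝ} (hl : ∀ᶠ x in l, 0 < x) :
    foxHposM m p a α b β γ =O[l] fun x => x ^ (-γ) := by
  refine Asymptotics.IsBigO.of_bound
    (1 / (2 * π) * ∫ t : ℝ, ‖foxKernelM m p a α b β (γ + t * I)‖) ?_
  filter_upwards [hl] with x hx
  rw [Real.norm_of_nonneg (Real.rpow_nonneg hx.le _)]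
  exact foxHposM_norm_le γ hx

/-- The Mellin transform of the Fox-H function is its kernel. -/
lemma mellin_foxHposM (hα : ∀ i < p, 0 < α i) (hβ : ∀ j < m, 0 < β j)
    (hΔ : 0 < ∑ j ∈ Finset.range m, β j - ∑ i ∈ Finset.range p, α i)
    {γ σ : ℝ} (hγ : ∀ j < m, 0 < b j + β j * γ) (hσ : ∀ j < m, 0 < b j + β j * σ) :
    MellinConvergent (foxHposM m p a α b β γ) σ ∧
      mellin (foxHposM m p a α b β γ) σ = foxKernelM m p a α b β σ := by
  set K := foxKernelM m p a α b β
  have hdiff : DifferentiableOn ℂ K {z | σ ≤ z.re ∧ z.re ≤ σ} :=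
    foxKernelM_differentiableOn fun z hz j hj => by
      linarith [hσ j hj, mul_le_mul_of_nonneg_left hz.1 (hβ j hj).le]
  have hint : Complex.VerticalIntegrable K σ :=
    (foxKernelM_hasStripDecay hα hβ hΔ hσ σ).integrable_vertical hdiff le_rfl le_rfl
  have hinv : Set.EqOn (foxHposM m p a α b β γ) (mellinInv σ K) (Set.Ioi 0) := fun x hx => by
    rw [foxHposM_eq hα hβ hΔ hγ hσ, foxHposM_eq_mellinInv σ hx]
  obtain ⟨τ, hτ, hτσ⟩ : ∃ τ, (∀ j < m, 0 < b j + β j * τ) ∧ τ < σ := by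
    have h1 : ∀ᶠ τ in nhdsWithin σ (Set.Iio σ), ∀ j ∈ Finset.range m, 0 < b j + β j * τ := by
      rw [Finset.eventually_all]
      intro j hj
      refine nhdsWithin_le_nhds ?_
      exact (by fun_prop : Continuous fun τ : ℝ => b j + β j * τ).continuousAt.eventually
        (lt_mem_nhds (hσ j (Finset.mem_range.1 hj)))
    obtain ⟨τ, h1, h2⟩ := (h1.and self_mem_nhdsWithin).exists
    exact ⟨τ, fun j hj => h1 j (Finset.mem_range.2 hj), h2⟩
  have hσ' : ∀ j < m, 0 < b j + β j * (σ + 1) := fun j hj => by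
    linarith [hσ j hj, hβ j hj]
  have hconv : MellinConvergent (foxHposM m p a α b β γ) σ := by
    refine mellinConvergent_of_isBigO_rpow (a := σ + 1) (b := τ)
      (((continuousOn_mellinInv hint).congr hinv).locallyIntegrableOn measurableSet_Ioi)
      ?_ (by simp) ?_ (by simpa using hτσ)
    · rw [foxHposM_eq hα hβ hΔ hγ hσ']
      exact foxHposM_isBigO _ (eventually_gt_atTop 0)
    · rw [foxHposM_eq hα hβ hΔ hγ hτ]
      exact foxHposM_isBigO _ self_mem_nhdsWithin
  refine ⟨hconv, ?_⟩
  rw [← mellin_mellinInv_eq hint (continuous_vertical hdiff le_rfl le_rfl)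
    (hconv.congr_fun (fun x hx => by simp only [hinv hx]) measurableSet_Ioi)]
  exact setIntegral_congr_fun measurableSet_Ioi fun x hx => by simp only [hinv hx]

end FoxH

/-- Fox-H densities of type `(m,0;p,m)` with `Δ > 0` have all moments finite,
with the `l`-th moment given by `∏_j Γ(bⱼ+βⱼ(l+1)) / ∏_i Γ(aᵢ+αᵢ(l+1))`. -/
theorem foxH_all_moments
    (m p : ℕ) (hm : 1 ≤ m)
    (a α b β : ℕ → ℝ)
    (hα : ∀ i < p, 0 < α i) (hβ : ∀ j < m, 0 < β j)
    (hb : ∀ j < m, 0 < b j + β j) (ha : ∀ i < p, 0 < a i + α i)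
    (hΔ : 0 < ∑ j ∈ Finset.range m, β j - ∑ i ∈ Finset.range p, α i)
    (γ : ℝ) (hγ : ∀ j < m, -(b j) / β j < γ)
    (hH : ∀ x > (0 : ℝ), (foxHposM m p a α b β γ x).im = 0 ∧
      0 ≤ (foxHposM m p a α b β γ x).re) :
    ∀ l : ℕ,
      IntegrableOn (fun x : ℝ => (x : ℂ) ^ l * foxHposM m p a α b β γ x) (Set.Ioi 0) volume ∧
      (∫ x in Set.Ioi (0 : ℝ), (x : ℂ) ^ l * foxHposM m p a α b β γ x) =
        (∏ j ∈ Finset.range m, Complex.Gamma (b j + β j * (l + 1))) /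
        (∏ i ∈ Finset.range p, Complex.Gamma (a i + α i * (l + 1))) := by
  have hgood : ∀ j < m, 0 < b j + β j * γ := fun j hj => by
    have := (div_lt_iff₀ (hβ j hj)).1 (hγ j hj)
    linarith
  intro l
  have hl : ∀ j < m, 0 < b j + β j * ((l : ℝ) + 1) := fun j hj => by
    linarith [hb j hj, mul_nonneg (hβ j hj).le (Nat.cast_nonneg (α := ℝ) l)]
  obtain ⟨hconv, hmellin⟩ := mellin_foxHposM (a := a) hα hβ hΔ hgood hl
  simp only [MellinConvergent, mellin, foxKernelM, Complex.ofReal_add, Complex.ofReal_natCast,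
    Complex.ofReal_one, add_sub_cancel_right, Complex.cpow_natCast, smul_eq_mul]
    at hconv hmellin
  exact ⟨hconv, hmellin⟩
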